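/- Let γ ∈ (0,1], ν > 0, ε > 0, K ∈ S_γ(ν), and let ĝ ∈ ℝ^{m×p} satisfy ‖ĝ − ∇J_γ(K)‖_F ≤ ε/3. Let the stepsize η satisfy 0 < η ≤ min{D/(G⁰ + ε), 1/(2L)}, where D = 1/(8κ³ψφ), L = 104κ¹⁰ℓ₁ψ²φ√(min{m,p}), and G⁰ = 2κ³φ(ℓ₁ + ψν)√(min{m,p}). Then the updated gain K⁺ = K − ηĝ satisfies K⁺ ∈ S_γ and J_γ(K⁺) ≤ J_γ(K) − η·((1/2)‖ĝ‖²_F − ε²/9). -/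

import Mathlib

open Matrix

noncomputable section

/-- Spectral radius of a real square matrix: the largest modulus of a complex eigenvalue. -/
def specRad {n : ℕ} (M : Matrix (Fin n) (Fin n) ℝ) : ℝ :=
  sSup {r : ℝ | ∃ μ ∈ spectrum ℂ (M.map (algebraMap ℝ ℂ)), r = ‖μ‖}

/-- Spectral (ℓ²→ℓ² operator) norm of a real matrix. -/
def spNorm {a b : ℕ} (M : Matrix (Fin a) (Fin b) ℝ) : ℝ :=
  ‖LinearMap.toContinuousLinearMap (Matrix.toEuclideanLin M)‖

/-- Frobenius norm of a real matrix. -/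
def frobNorm {a b : ℕ} (M : Matrix (Fin a) (Fin b) ℝ) : ℝ :=
  Real.sqrt (∑ i, ∑ j, (M i j) ^ 2)

/-- Euclidean norm of a vector. -/
def vecNorm {a : ℕ} (x : Fin a → ℝ) : ℝ :=
  Real.sqrt (∑ i, (x i) ^ 2)

variable {n m p : ℕ}

/-- Closed-loop matrix `A - BKC`. -/
def Acl (A : Matrix (Fin n) (Fin n) ℝ) (B : Matrix (Fin n) (Fin m) ℝ)
    (C : Matrix (Fin p) (Fin n) ℝ) (K : Matrix (Fin m) (Fin p) ℝ) : Matrix (Fin n) (Fin n) ℝ :=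
  A - B * K * C

/-- Membership in the stabilizing set `S_γ`: `√γ · ρ(A − BKC) < 1`. -/
def inS (A : Matrix (Fin n) (Fin n) ℝ) (B : Matrix (Fin n) (Fin m) ℝ)
    (C : Matrix (Fin p) (Fin n) ℝ) (γ : ℝ) (K : Matrix (Fin m) (Fin p) ℝ) : Prop :=
  Real.sqrt γ * specRad (Acl A B C K) < 1

/-- The solution `P_K(γ) = Σ_{t} γ^t ((A−BKC)ᵀ)^t (Q + CᵀKᵀRKC) (A−BKC)^t` of the
discounted Lyapunov equation. -/
def Pmat (A : Matrix (Fin n) (Fin n) ℝ) (B : Matrix (Fin n) (Fin m) ℝ)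
    (C : Matrix (Fin p) (Fin n) ℝ) (Q : Matrix (Fin n) (Fin n) ℝ) (R : Matrix (Fin m) (Fin m) ℝ)
    (γ : ℝ) (K : Matrix (Fin m) (Fin p) ℝ) : Matrix (Fin n) (Fin n) ℝ :=
  ∑' t : ℕ, γ ^ t • ((Acl A B C K)ᵀ ^ t * (Q + Cᵀ * Kᵀ * R * K * C) * (Acl A B C K) ^ t)

/-- The Gramian `Σ_K(γ) = Σ_{t} γ^t (A−BKC)^t ((A−BKC)ᵀ)^t`. -/
def Smat (A : Matrix (Fin n) (Fin n) ℝ) (B : Matrix (Fin n) (Fin m) ℝ)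
    (C : Matrix (Fin p) (Fin n) ℝ) (γ : ℝ) (K : Matrix (Fin m) (Fin p) ℝ) :
    Matrix (Fin n) (Fin n) ℝ :=
  ∑' t : ℕ, γ ^ t • ((Acl A B C K) ^ t * ((Acl A B C K)ᵀ) ^ t)

/-- The discounted cost `J_γ(K) = Tr(P_K(γ))`. -/
def Jcost (A : Matrix (Fin n) (Fin n) ℝ) (B : Matrix (Fin n) (Fin m) ℝ)
    (C : Matrix (Fin p) (Fin n) ℝ) (Q : Matrix (Fin n) (Fin n) ℝ) (R : Matrix (Fin m) (Fin m) ℝ)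
    (γ : ℝ) (K : Matrix (Fin m) (Fin p) ℝ) : ℝ :=
  (Pmat A B C Q R γ K).trace

/-- `E_K = (R + γBᵀP_K(γ)B)KC − γBᵀP_K(γ)A`. -/
def Egrad (A : Matrix (Fin n) (Fin n) ℝ) (B : Matrix (Fin n) (Fin m) ℝ)
    (C : Matrix (Fin p) (Fin n) ℝ) (Q : Matrix (Fin n) (Fin n) ℝ) (R : Matrix (Fin m) (Fin m) ℝ)
    (γ : ℝ) (K : Matrix (Fin m) (Fin p) ℝ) : Matrix (Fin m) (Fin n) ℝ :=
  (R + γ • (Bᵀ * Pmat A B C Q R γ K * B)) * K * C - γ • (Bᵀ * Pmat A B C Q R γ K * A)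

/-- The closed-form gradient `∇J_γ(K) = 2 E_K Σ_K(γ) Cᵀ`. -/
def gradJ (A : Matrix (Fin n) (Fin n) ℝ) (B : Matrix (Fin n) (Fin m) ℝ)
    (C : Matrix (Fin p) (Fin n) ℝ) (Q : Matrix (Fin n) (Fin n) ℝ) (R : Matrix (Fin m) (Fin m) ℝ)
    (γ : ℝ) (K : Matrix (Fin m) (Fin p) ℝ) : Matrix (Fin m) (Fin p) ℝ :=
  (2 : ℝ) • (Egrad A B C Q R γ K * Smat A B C γ K * Cᵀ)

end

/-- The powers of `M` decay geometrically in Frobenius norm. -/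
def PowDecay {n : ℕ} (M : Matrix (Fin n) (Fin n) ℝ) : Prop :=
  ∃ r : ℝ, 0 ≤ r ∧ r < 1 ∧ ∀ᶠ t : ℕ in Filter.atTop, frobNorm (M ^ t) ≤ r ^ t

open scoped Pointwise in
/-- For a stabilizing gain, the powers of `√γ • (A − BKC)` decay geometrically in Frobenius norm. -/
lemma powDecay_of_inS {n m p : ℕ} {A : Matrix (Fin n) (Fin n) ℝ}
    {B : Matrix (Fin n) (Fin m) ℝ} {C : Matrix (Fin p) (Fin n) ℝ} {γ : ℝ}
    {K : Matrix (Fin m) (Fin p) ℝ} (hn : 1 ≤ n) (hγ : 0 < γ) (hK : inS A B C γ K) :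
    PowDecay (√γ • Acl A B C K) := by
  let : NormedRing (Matrix (Fin n) (Fin n) ℂ) := Matrix.frobeniusNormedRing
  let : NormedAlgebra ℂ (Matrix (Fin n) (Fin n) ℂ) := Matrix.frobeniusNormedAlgebra
  have : CompleteSpace (Matrix (Fin n) (Fin n) ℂ) := FiniteDimensional.complete ℂ _
  have : Nonempty (Fin n) := ⟨⟨0, hn⟩⟩
  set M := Acl A B C K with hM
  set Mc := M.map (algebraMap ℝ ℂ) with hMc
  set a : Matrix (Fin n) (Fin n) ℂ := (√γ • M).map (algebraMap ℝ ℂ) with ha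
  have hs : 0 < √γ := Real.sqrt_pos.2 hγ
  have haM : a = ((√γ : ℝ) : ℂ) • Mc := by
    ext i j; simp [ha, hMc]
  have hr : √γ * specRad M < 1 := hK
  have hbdd : BddAbove {r : ℝ | ∃ μ ∈ spectrum ℂ Mc, r = ‖μ‖} := by
    obtain ⟨c, hc⟩ := (spectrum.isBounded (𝕜 := ℂ) Mc).exists_norm_le
    exact ⟨c, by rintro _ ⟨μ, hμ, rfl⟩; exact hc μ hμ⟩
  have hspec : ∀ μ ∈ spectrum ℂ a, ‖μ‖ < 1 := by
    intro μ hμ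
    have hne : ((√γ : ℝ) : ℂ) ≠ 0 := by exact_mod_cast hs.ne'
    have h2 : spectrum ℂ a = (Units.mk0 _ hne) • spectrum ℂ Mc := by
      rw [haM]; exact spectrum.unit_smul_eq_smul Mc (Units.mk0 _ hne)
    rw [h2] at hμ
    obtain ⟨μ', hμ', rfl⟩ := hμ
    have : ‖μ'‖ ≤ specRad M := le_csSup hbdd ⟨μ', hμ', rfl⟩
    calc ‖(Units.mk0 _ hne) • μ'‖ = √γ * ‖μ'‖ := by
          simp [Units.smul_def, abs_of_pos hs]
      _ ≤ √γ * specRad M := by gcongr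
      _ < 1 := hr
  have hrad : spectralRadius ℂ a < 1 := by
    have := spectrum.spectralRadius_lt_of_forall_lt a (r := 1)
      (fun μ hμ => by exact_mod_cast hspec μ hμ)
    simpa using this
  obtain ⟨r, hr1, hr2⟩ := ENNReal.lt_iff_exists_nnreal_btwn.1 hrad
  refine ⟨r, r.2, by exact_mod_cast hr2, ?_⟩
  have hlim := spectrum.pow_nnnorm_pow_one_div_tendsto_nhds_spectralRadius a
  filter_upwards [hlim.eventually_lt_const hr1, Filter.eventually_gt_atTop 0] with t ht ht0
  have h3 : (‖a ^ t‖₊ : ENNReal) ≤ (r : ENNReal) ^ t := by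
    have h4 := ENNReal.rpow_le_rpow ht.le (z := (t : ℝ)) (by positivity)
    rw [← ENNReal.rpow_mul, one_div, inv_mul_cancel₀ (by positivity), ENNReal.rpow_one,
      ENNReal.rpow_natCast] at h4
    exact h4
  have h5 : ‖a ^ t‖ ≤ (r : ℝ) ^ t := by exact_mod_cast h3
  have h6 : a ^ t = ((√γ • M) ^ t).map (algebraMap ℝ ℂ) := by
    rw [ha]; exact (Matrix.map_pow _ (algebraMap ℝ ℂ) t).symm
  have h7 : frobNorm ((√γ • M) ^ t) = ‖a ^ t‖ := by
    rw [h6, Matrix.frobenius_norm_def, frobNorm, Real.sqrt_eq_rpow]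
    simp
  rw [h7]; exact h5

lemma frobNorm_nonneg {a b : ℕ} (M : Matrix (Fin a) (Fin b) ℝ) : 0 ≤ frobNorm M :=
  Real.sqrt_nonneg _

lemma frobNorm_sq {a b : ℕ} (M : Matrix (Fin a) (Fin b) ℝ) :
    frobNorm M ^ 2 = ∑ i, ∑ j, M i j ^ 2 :=
  Real.sq_sqrt (Finset.sum_nonneg fun _ _ => Finset.sum_nonneg fun _ _ => sq_nonneg _)

lemma frobNorm_transpose {a b : ℕ} (M : Matrix (Fin a) (Fin b) ℝ) : frobNorm Mᵀ = frobNorm M := by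
  simp only [frobNorm, Matrix.transpose_apply]
  rw [Finset.sum_comm]

section FrobeniusNorm

attribute [local instance] Matrix.frobeniusNormedAddCommGroup Matrix.frobeniusNormedSpace

lemma frobNorm_eq_norm {a b : ℕ} (M : Matrix (Fin a) (Fin b) ℝ) : frobNorm M = ‖M‖ := by
  rw [Matrix.frobenius_norm_def, frobNorm, Real.sqrt_eq_rpow]
  simp

lemma frobNorm_add_le {a b : ℕ} (M N : Matrix (Fin a) (Fin b) ℝ) :
    frobNorm (M + N) ≤ frobNorm M + frobNorm N := by
  simpa only [frobNorm_eq_norm] using norm_add_le M N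

lemma frobNorm_sub_le {a b : ℕ} (M N : Matrix (Fin a) (Fin b) ℝ) :
    frobNorm (M - N) ≤ frobNorm M + frobNorm N := by
  simpa only [frobNorm_eq_norm] using norm_sub_le M N

lemma frobNorm_smul {a b : ℕ} (c : ℝ) (M : Matrix (Fin a) (Fin b) ℝ) :
    frobNorm (c • M) = |c| * frobNorm M := by
  simpa only [frobNorm_eq_norm, Real.norm_eq_abs] using norm_smul c M

lemma frobNorm_mul_le {a b c : ℕ} (M : Matrix (Fin a) (Fin b) ℝ) (N : Matrix (Fin b) (Fin c) ℝ) :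
    frobNorm (M * N) ≤ frobNorm M * frobNorm N := by
  simpa only [frobNorm_eq_norm] using Matrix.frobenius_norm_mul M N

lemma abs_apply_le_frobNorm {a b : ℕ} (M : Matrix (Fin a) (Fin b) ℝ) (i : Fin a) (j : Fin b) :
    |M i j| ≤ frobNorm M := by
  refine Real.abs_le_sqrt ?_
  refine le_trans ?_ (Finset.single_le_sum
    (fun i _ => Finset.sum_nonneg fun j _ => sq_nonneg (M i j)) (Finset.mem_univ i))
  exact Finset.single_le_sum (f := fun j => M i j ^ 2) (fun j _ => sq_nonneg _) (Finset.mem_univ j)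

end FrobeniusNorm

lemma frobNorm_sq_eq_trace {a b : ℕ} (M : Matrix (Fin a) (Fin b) ℝ) :
    frobNorm M ^ 2 = (M * Mᵀ).trace := by
  rw [frobNorm_sq]
  simp [Matrix.trace, Matrix.mul_apply, sq]

lemma frobNorm_sq_eq_trace' {a b : ℕ} (M : Matrix (Fin a) (Fin b) ℝ) :
    frobNorm M ^ 2 = (Mᵀ * M).trace := by
  rw [frobNorm_sq_eq_trace, Matrix.trace_mul_comm]

lemma trace_mul_transpose_le {a b : ℕ} (M N : Matrix (Fin a) (Fin b) ℝ) :
    |(M * Nᵀ).trace| ≤ frobNorm M * frobNorm N := by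
  have h : (M * Nᵀ).trace = ∑ x : Fin a × Fin b, M x.1 x.2 * N x.1 x.2 := by
    rw [Fintype.sum_prod_type]; simp [Matrix.trace, Matrix.mul_apply]
  have h2 : ∀ L : Matrix (Fin a) (Fin b) ℝ,
      frobNorm L ^ 2 = ∑ x : Fin a × Fin b, L x.1 x.2 ^ 2 := by
    intro L; rw [frobNorm_sq, Fintype.sum_prod_type]
  refine abs_le_of_sq_le_sq ?_ (mul_nonneg (frobNorm_nonneg _) (frobNorm_nonneg _))
  rw [mul_pow, h2, h2, h]
  exact Finset.sum_mul_sq_le_sq_mul_sq _ _ _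

lemma vecNorm_nonneg {a : ℕ} (v : Fin a → ℝ) : 0 ≤ vecNorm v := Real.sqrt_nonneg _

lemma vecNorm_sq {a : ℕ} (v : Fin a → ℝ) : vecNorm v ^ 2 = v ⬝ᵥ v := by
  rw [vecNorm, Real.sq_sqrt (Finset.sum_nonneg fun _ _ => sq_nonneg _)]
  simp [dotProduct, sq]

lemma vecNorm_eq_norm {a : ℕ} (v : Fin a → ℝ) : vecNorm v = ‖WithLp.toLp 2 v‖ := by
  simp [EuclideanSpace.norm_eq, vecNorm]

lemma dotProduct_le_vecNorm {a : ℕ} (u v : Fin a → ℝ) :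
    |u ⬝ᵥ v| ≤ vecNorm u * vecNorm v := by
  refine abs_le_of_sq_le_sq ?_ (mul_nonneg (vecNorm_nonneg _) (vecNorm_nonneg _))
  rw [mul_pow, vecNorm_sq, vecNorm_sq]
  simpa [dotProduct, sq] using Finset.sum_mul_sq_le_sq_mul_sq Finset.univ u v

lemma spNorm_nonneg {a b : ℕ} (M : Matrix (Fin a) (Fin b) ℝ) : 0 ≤ spNorm M := norm_nonneg _

lemma vecNorm_mulVec_le {a b : ℕ} (M : Matrix (Fin a) (Fin b) ℝ) (v : Fin b → ℝ) :
    vecNorm (M *ᵥ v) ≤ spNorm M * vecNorm v := by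
  rw [vecNorm_eq_norm, vecNorm_eq_norm]
  exact (LinearMap.toContinuousLinearMap (Matrix.toEuclideanLin M)).le_opNorm (WithLp.toLp 2 v)

lemma spNorm_le_of_mulVec {a b : ℕ} {M : Matrix (Fin a) (Fin b) ℝ} {c : ℝ} (hc : 0 ≤ c)
    (h : ∀ v, vecNorm (M *ᵥ v) ≤ c * vecNorm v) : spNorm M ≤ c := by
  refine ContinuousLinearMap.opNorm_le_bound _ hc fun x => ?_
  have := h x.ofLp
  rw [vecNorm_eq_norm, vecNorm_eq_norm] at this
  exact this

section L2OpNorm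

open scoped Matrix.Norms.L2Operator

lemma spNorm_mul_le {a b c : ℕ} (M : Matrix (Fin a) (Fin b) ℝ) (N : Matrix (Fin b) (Fin c) ℝ) :
    spNorm (M * N) ≤ spNorm M * spNorm N :=
  Matrix.l2_opNorm_mul M N

lemma spNorm_transpose {a b : ℕ} (M : Matrix (Fin a) (Fin b) ℝ) : spNorm Mᵀ = spNorm M := by
  rw [← Matrix.conjTranspose_eq_transpose_of_trivial]
  exact Matrix.l2_opNorm_conjTranspose M

lemma spNorm_smul {a b : ℕ} (c : ℝ) (M : Matrix (Fin a) (Fin b) ℝ) :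
    spNorm (c • M) = |c| * spNorm M :=
  norm_smul c M

lemma spNorm_add_le {a b : ℕ} (M N : Matrix (Fin a) (Fin b) ℝ) :
    spNorm (M + N) ≤ spNorm M + spNorm N :=
  norm_add_le M N

end L2OpNorm

lemma frobNorm_mul_le_spNorm_mul {a b c : ℕ} (M : Matrix (Fin a) (Fin b) ℝ)
    (N : Matrix (Fin b) (Fin c) ℝ) : frobNorm (M * N) ≤ spNorm M * frobNorm N := by
  refine (pow_le_pow_iff_left₀ (frobNorm_nonneg _)
    (mul_nonneg (spNorm_nonneg _) (frobNorm_nonneg _)) two_ne_zero).1 ?_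
  have h : ∀ {a b : ℕ} (L : Matrix (Fin a) (Fin b) ℝ),
      frobNorm L ^ 2 = ∑ j, vecNorm (fun i => L i j) ^ 2 := by
    intro a b L
    rw [frobNorm_sq, Finset.sum_comm]
    simp only [vecNorm_sq, dotProduct]
    simp only [sq]
  rw [mul_pow, h, h, Finset.mul_sum]
  refine Finset.sum_le_sum fun j _ => ?_
  rw [← mul_pow]
  exact pow_le_pow_left₀ (vecNorm_nonneg _) (vecNorm_mulVec_le M (fun i => N i j)) 2

lemma frobNorm_mul_le_mul_spNorm {a b c : ℕ} (M : Matrix (Fin a) (Fin b) ℝ)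
    (N : Matrix (Fin b) (Fin c) ℝ) : frobNorm (M * N) ≤ frobNorm M * spNorm N := by
  rw [← frobNorm_transpose, Matrix.transpose_mul, ← frobNorm_transpose M, ← spNorm_transpose N,
    mul_comm]
  exact frobNorm_mul_le_spNorm_mul _ _

lemma vecNorm_mulVec_le_frobNorm {a b : ℕ} (M : Matrix (Fin a) (Fin b) ℝ) (v : Fin b → ℝ) :
    vecNorm (M *ᵥ v) ≤ frobNorm M * vecNorm v := by
  have h : ∀ {a : ℕ} (w : Fin a → ℝ), vecNorm w = frobNorm (Matrix.replicateCol (Fin 1) w) := by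
    intro a w; simp [vecNorm, frobNorm]
  rw [h, h, Matrix.replicateCol_mulVec]
  exact frobNorm_mul_le _ _

lemma spNorm_le_frobNorm {a b : ℕ} (M : Matrix (Fin a) (Fin b) ℝ) : spNorm M ≤ frobNorm M :=
  spNorm_le_of_mulVec (frobNorm_nonneg _) (vecNorm_mulVec_le_frobNorm M)

/-- A symmetric bilinear form with quadratic form bounded by `c` has spectral norm at most `c`. -/
lemma spNorm_le_of_abs_dotProduct_le {a : ℕ} {M : Matrix (Fin a) (Fin a) ℝ} (hM : M.IsSymm)
    {c : ℝ} (hc : 0 ≤ c) (h : ∀ v, |v ⬝ᵥ (M *ᵥ v)| ≤ c * (v ⬝ᵥ v)) : spNorm M ≤ c := by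
  have hsymm : ∀ u v, v ⬝ᵥ (M *ᵥ u) = u ⬝ᵥ (M *ᵥ v) := by
    intro u v
    rw [Matrix.dotProduct_mulVec, ← Matrix.mulVec_transpose, hM.eq, dotProduct_comm]
  have hpol : ∀ u v, u ⬝ᵥ (M *ᵥ v) ≤ c / 2 * (u ⬝ᵥ u + v ⬝ᵥ v) := by
    intro u v
    have h1 := (abs_le.1 (h (u + v))).2
    have h2 := (abs_le.1 (h (u - v))).1
    simp only [Matrix.mulVec_add, Matrix.mulVec_sub, dotProduct_add, dotProduct_sub,
      add_dotProduct, sub_dotProduct] at h1 h2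
    rw [hsymm u v] at h1 h2
    rw [dotProduct_comm v u] at h1 h2
    linarith
  refine spNorm_le_of_mulVec hc fun v => ?_
  have key : ∀ s : ℝ, 2 * s * vecNorm (M *ᵥ v) ^ 2 ≤
      c * (s ^ 2 * vecNorm (M *ᵥ v) ^ 2 + vecNorm v ^ 2) := by
    intro s
    have := hpol (s • (M *ᵥ v)) v
    simp only [smul_dotProduct, dotProduct_smul, smul_eq_mul] at this
    rw [vecNorm_sq, vecNorm_sq]
    nlinarith
  set x := vecNorm (M *ᵥ v)
  set y := vecNorm v
  have hx : 0 ≤ x := vecNorm_nonneg _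
  have hy : 0 ≤ y := vecNorm_nonneg _
  rcases hx.eq_or_lt with h0 | hx
  · rw [← h0]; positivity
  have := key (y / x)
  field_simp at this
  rcases hy.eq_or_lt with h0 | hy
  · have h3 := key (1 / (c + 1))
    rw [← h0] at h3
    field_simp at h3
    rw [← h0]
    nlinarith [sq_nonneg x]
  · nlinarith

lemma PowDecay.transpose {n : ℕ} {M : Matrix (Fin n) (Fin n) ℝ} (h : PowDecay M) :
    PowDecay Mᵀ := by
  obtain ⟨r, h0, h1, h2⟩ := h
  refine ⟨r, h0, h1, ?_⟩
  filter_upwards [h2] with t ht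
  rwa [← Matrix.transpose_pow, frobNorm_transpose]

lemma PowDecay.tendsto {n : ℕ} {M : Matrix (Fin n) (Fin n) ℝ} (h : PowDecay M) :
    Filter.Tendsto (fun t : ℕ => M ^ t) Filter.atTop (nhds 0) := by
  obtain ⟨r, h0, h1, h2⟩ := h
  refine tendsto_pi_nhds.2 fun i => tendsto_pi_nhds.2 fun j => ?_
  refine squeeze_zero_norm' ?_ (tendsto_pow_atTop_nhds_zero_of_lt_one h0 h1)
  filter_upwards [h2] with t ht
  exact (abs_apply_le_frobNorm (M ^ t) i j).trans ht

lemma PowDecay.summable {n : ℕ} {M : Matrix (Fin n) (Fin n) ℝ} (h : PowDecay M)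
    (N : Matrix (Fin n) (Fin n) ℝ) : Summable (fun t : ℕ => M ^ t * N * Mᵀ ^ t) := by
  obtain ⟨r, h0, h1, h2⟩ := h
  refine Pi.summable.2 fun i => Pi.summable.2 fun j => ?_
  have hr : r * r < 1 := by nlinarith
  refine Summable.of_norm_bounded_eventually_nat (g := fun t => (r * r) ^ t * frobNorm N)
    ((summable_geometric_of_lt_one (by positivity) hr).mul_right _) ?_
  filter_upwards [h2] with t ht
  have h3 : frobNorm (Mᵀ ^ t) ≤ r ^ t := by
    rwa [← Matrix.transpose_pow, frobNorm_transpose]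
  have hN := frobNorm_nonneg N
  calc ‖(M ^ t * N * Mᵀ ^ t) i j‖ ≤ frobNorm (M ^ t * N * Mᵀ ^ t) := abs_apply_le_frobNorm _ i j
    _ ≤ frobNorm (M ^ t) * frobNorm N * frobNorm (Mᵀ ^ t) :=
        (frobNorm_mul_le _ _).trans
          (mul_le_mul_of_nonneg_right (frobNorm_mul_le _ _) (frobNorm_nonneg _))
    _ ≤ r ^ t * frobNorm N * r ^ t :=
        mul_le_mul (mul_le_mul_of_nonneg_right ht hN) h3 (frobNorm_nonneg _) (by positivity)
    _ = (r * r) ^ t * frobNorm N := by rw [mul_pow]; ring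

lemma PowDecay.lyapunov_eq {n : ℕ} {M : Matrix (Fin n) (Fin n) ℝ} (h : PowDecay M)
    (N : Matrix (Fin n) (Fin n) ℝ) :
    ∑' t : ℕ, M ^ t * N * Mᵀ ^ t = N + M * (∑' t : ℕ, M ^ t * N * Mᵀ ^ t) * Mᵀ := by
  have hs := h.summable N
  conv_lhs => rw [hs.tsum_eq_zero_add]
  rw [← hs.tsum_mul_left, ← (hs.mul_left M).tsum_mul_right]
  congr 1
  · simp
  · refine tsum_congr fun t => ?_
    rw [pow_succ' M, pow_succ Mᵀ]
    simp only [Matrix.mul_assoc]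

lemma PowDecay.posSemidef {n : ℕ} {M Y : Matrix (Fin n) (Fin n) ℝ} (h : PowDecay M)
    (hY : (Y - M * Y * Mᵀ).PosSemidef) : Y.PosSemidef := by
  have hstep : ∀ t : ℕ, (Y - M ^ t * Y * (M ^ t)ᵀ).PosSemidef := by
    intro t
    induction t with
    | zero => simpa using Matrix.PosSemidef.zero
    | succ t ih =>
      have h1 := hY.mul_mul_conjTranspose_same (M ^ t)
      rw [Matrix.conjTranspose_eq_transpose_of_trivial] at h1
      convert ih.add h1 using 1
      rw [pow_succ M, Matrix.transpose_mul]
      simp only [Matrix.mul_sub, Matrix.sub_mul, Matrix.mul_assoc]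
      abel
  have hlim : Filter.Tendsto (fun t : ℕ => Y - M ^ t * Y * (M ^ t)ᵀ) Filter.atTop (nhds Y) := by
    have hc : Continuous fun Z : Matrix (Fin n) (Fin n) ℝ => Y - Z * Y * Zᵀ := by fun_prop
    have := (hc.tendsto 0).comp h.tendsto
    rwa [Matrix.zero_mul, Matrix.zero_mul, sub_zero] at this
  refine Matrix.PosSemidef.of_dotProduct_mulVec_nonneg ?_ fun x => ?_
  · have hc : Continuous fun Z : Matrix (Fin n) (Fin n) ℝ => Zᴴ := by fun_prop
    refine tendsto_nhds_unique ((hc.tendsto Y).comp hlim) (hlim.congr fun t => ?_)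
    exact (hstep t).1.symm
  · have hc : Continuous fun Z : Matrix (Fin n) (Fin n) ℝ => star x ⬝ᵥ (Z *ᵥ x) := by fun_prop
    exact ge_of_tendsto' ((hc.tendsto Y).comp hlim) fun t => (hstep t).dotProduct_mulVec_nonneg x

/-- A quadratic Lyapunov certificate for the (transposed) closed loop implies stability. -/
lemma inS_of_certificate {n m p : ℕ} {A : Matrix (Fin n) (Fin n) ℝ}
    {B : Matrix (Fin n) (Fin m) ℝ} {C : Matrix (Fin p) (Fin n) ℝ} {γ : ℝ}
    {K : Matrix (Fin m) (Fin p) ℝ} {S : Matrix (Fin n) (Fin n) ℝ} {b c : ℝ} (hγ : 0 < γ)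
    (hb : 0 < b) (hc : 0 < c) (hS : S.PosSemidef) (hub : ∀ v, v ⬝ᵥ (S *ᵥ v) ≤ b * (v ⬝ᵥ v))
    (hcert : ∀ v, γ * (((Acl A B C K)ᵀ *ᵥ v) ⬝ᵥ (S *ᵥ ((Acl A B C K)ᵀ *ᵥ v))) ≤
      v ⬝ᵥ (S *ᵥ v) - c * (v ⬝ᵥ v)) : inS A B C γ K := by
  set M := Acl A B C K with hM
  have hs : 0 < √γ := Real.sqrt_pos.2 hγ
  have hβ : √(1 - c / b) < 1 := by
    rw [Real.sqrt_lt' one_pos]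
    have : 0 < c / b := by positivity
    linarith
  have hle : specRad M ≤ √(1 - c / b) / √γ := by
    refine Real.sSup_le ?_ (by positivity)
    rintro _ ⟨μ, hμ, rfl⟩
    rw [spectrum.mem_iff, Matrix.isUnit_iff_isUnit_det, isUnit_iff_ne_zero, not_not,
      ← Matrix.exists_vecMul_eq_zero_iff] at hμ
    obtain ⟨v, hv0, hv⟩ := hμ
    rw [Matrix.vecMul_sub, sub_eq_zero, Algebra.algebraMap_eq_smul_one,
      Matrix.vecMul_smul, Matrix.vecMul_one] at hv
    have hv' : ∀ j, μ * v j = ∑ i, v i * (M i j : ℂ) := by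
      intro j
      have := congrFun hv j
      simpa [Matrix.vecMul, dotProduct] using this
    set x : Fin n → ℝ := fun i => (v i).re with hx
    set y : Fin n → ℝ := fun i => (v i).im with hy
    have hMx : Mᵀ *ᵥ x = μ.re • x - μ.im • y := by
      ext j
      have := congrArg Complex.re (hv' j)
      simp [Complex.mul_re] at this
      simp [Matrix.mulVec, dotProduct, hx, hy, this, mul_comm]
    have hMy : Mᵀ *ᵥ y = μ.re • y + μ.im • x := by
      ext j
      have := congrArg Complex.im (hv' j)
      simp [Complex.mul_im] at this
      simp [Matrix.mulVec, dotProduct, hx, hy, this, mul_comm]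
    have hxy : 0 < x ⬝ᵥ x + y ⬝ᵥ y := by
      obtain ⟨i, hi⟩ := Function.ne_iff.1 hv0
      have h1 : 0 < Complex.normSq (v i) := Complex.normSq_pos.2 hi
      have h2 : x ⬝ᵥ x + y ⬝ᵥ y = ∑ i, Complex.normSq (v i) := by
        simp [dotProduct, Complex.normSq_apply, Finset.sum_add_distrib, hx, hy]
      rw [h2]
      exact h1.trans_le (Finset.single_le_sum (f := fun i => Complex.normSq (v i))
        (fun _ _ => Complex.normSq_nonneg _) (Finset.mem_univ i))
    have hsymm : y ⬝ᵥ (S *ᵥ x) = x ⬝ᵥ (S *ᵥ y) := by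
      rw [Matrix.dotProduct_mulVec, ← Matrix.mulVec_transpose,
        ← Matrix.conjTranspose_eq_transpose_of_trivial, hS.1.eq, dotProduct_comm]
    have h0 : 0 ≤ x ⬝ᵥ (S *ᵥ x) + y ⬝ᵥ (S *ᵥ y) :=
      add_nonneg (hS.dotProduct_mulVec_nonneg x) (hS.dotProduct_mulVec_nonneg y)
    have h1 := hcert x
    have h2 := hcert y
    have h3 := hub x
    have h4 := hub y
    rw [hMx] at h1
    rw [hMy] at h2
    simp only [Matrix.mulVec_add, Matrix.mulVec_sub, Matrix.mulVec_smul, dotProduct_add,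
      dotProduct_sub, add_dotProduct, sub_dotProduct, smul_dotProduct, dotProduct_smul,
      smul_eq_mul, hsymm] at h1 h2
    have hμ2 : ‖μ‖ ^ 2 = μ.re ^ 2 + μ.im ^ 2 := by
      rw [Complex.sq_norm, Complex.normSq_apply]; ring
    set q := x ⬝ᵥ (S *ᵥ x) + y ⬝ᵥ (S *ᵥ y) with hq
    have h5 : c * (x ⬝ᵥ x + y ⬝ᵥ y) ≤ (1 - γ * ‖μ‖ ^ 2) * q := by
      rw [hμ2, hq]; linarith
    have h6 : q ≤ b * (x ⬝ᵥ x + y ⬝ᵥ y) := by rw [hq]; linarith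
    have hq0 : 0 < q := by
      refine h0.lt_of_ne fun h => ?_
      rw [← h, mul_zero] at h5
      exact absurd h5 (not_le.2 (mul_pos hc hxy))
    have h7 : c * q ≤ (1 - γ * ‖μ‖ ^ 2) * b * q := by
      nlinarith
    have h8 := le_of_mul_le_mul_right h7 hq0
    have h9 : c / b ≤ 1 - γ * ‖μ‖ ^ 2 := by rwa [div_le_iff₀ hb]
    rw [le_div_iff₀ hs]
    refine Real.le_sqrt_of_sq_le ?_
    rw [mul_pow, Real.sq_sqrt hγ.le]
    linarith
  calc √γ * specRad M ≤ √γ * (√(1 - c / b) / √γ) := by gcongr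
    _ = √(1 - c / b) := by field_simp
    _ < 1 := hβ

lemma Matrix.PosSemidef.exists_transpose_mul_self {n : ℕ} {S : Matrix (Fin n) (Fin n) ℝ}
    (hS : S.PosSemidef) : ∃ N : Matrix (Fin n) (Fin n) ℝ, S = Nᵀ * N := by
  open scoped MatrixOrder in
  obtain ⟨N, hN⟩ := CStarAlgebra.nonneg_iff_eq_star_mul_self.1 hS.nonneg
  exact ⟨N, by rw [hN, Matrix.star_eq_conjTranspose, Matrix.conjTranspose_eq_transpose_of_trivial]⟩

lemma Matrix.PosSemidef.isSymm {n : ℕ} {S : Matrix (Fin n) (Fin n) ℝ} (hS : S.PosSemidef) :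
    S.IsSymm := by
  have := hS.1
  rwa [Matrix.IsHermitian, Matrix.conjTranspose_eq_transpose_of_trivial] at this

lemma Matrix.PosSemidef.quad_nonneg {n : ℕ} {S : Matrix (Fin n) (Fin n) ℝ} (hS : S.PosSemidef)
    (v : Fin n → ℝ) : 0 ≤ v ⬝ᵥ (S *ᵥ v) :=
  hS.dotProduct_mulVec_nonneg v

lemma Matrix.IsSymm.posSemidef_of_quad_nonneg {n : ℕ} {S : Matrix (Fin n) (Fin n) ℝ}
    (hS : S.IsSymm) (h : ∀ v, 0 ≤ v ⬝ᵥ (S *ᵥ v)) : S.PosSemidef :=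
  Matrix.PosSemidef.of_dotProduct_mulVec_nonneg
    (by rw [Matrix.IsHermitian, Matrix.conjTranspose_eq_transpose_of_trivial, hS.eq]) h

lemma Matrix.PosSemidef.congr_transpose {n k : ℕ} {S : Matrix (Fin n) (Fin n) ℝ}
    (hS : S.PosSemidef) (N : Matrix (Fin n) (Fin k) ℝ) : (Nᵀ * S * N).PosSemidef := by
  simpa [Matrix.conjTranspose_eq_transpose_of_trivial] using hS.conjTranspose_mul_mul_same N

lemma spNorm_transpose_mul_self {a b : ℕ} (M : Matrix (Fin a) (Fin b) ℝ) :
    spNorm (Mᵀ * M) = spNorm M * spNorm M := by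
  rw [← Matrix.conjTranspose_eq_transpose_of_trivial]
  exact Matrix.l2_opNorm_conjTranspose_mul_self M

lemma abs_dotProduct_mulVec_le {n : ℕ} (S : Matrix (Fin n) (Fin n) ℝ) (v : Fin n → ℝ) :
    |v ⬝ᵥ (S *ᵥ v)| ≤ spNorm S * (v ⬝ᵥ v) := by
  have h1 := dotProduct_le_vecNorm v (S *ᵥ v)
  have h2 := mul_le_mul_of_nonneg_left (vecNorm_mulVec_le S v) (vecNorm_nonneg v)
  rw [← vecNorm_sq]
  linarith

lemma trace_mul_nonneg_of_posSemidef {n : ℕ} {M S : Matrix (Fin n) (Fin n) ℝ}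
    (hM : M.PosSemidef) (hS : S.PosSemidef) : 0 ≤ (M * S).trace := by
  obtain ⟨N, rfl⟩ := hS.exists_transpose_mul_self
  have h := (hM.congr_transpose Nᵀ).trace_nonneg
  rwa [Matrix.transpose_transpose, Matrix.mul_assoc, Matrix.trace_mul_comm, Matrix.mul_assoc] at h

lemma spNorm_le_trace {n : ℕ} {S : Matrix (Fin n) (Fin n) ℝ} (hS : S.PosSemidef) :
    spNorm S ≤ S.trace := by
  obtain ⟨N, rfl⟩ := hS.exists_transpose_mul_self
  rw [spNorm_transpose_mul_self, ← frobNorm_sq_eq_trace', sq]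
  exact mul_self_le_mul_self (spNorm_nonneg _) (spNorm_le_frobNorm N)

lemma spNorm_le_of_loewner {n : ℕ} {S Z : Matrix (Fin n) (Fin n) ℝ} {c : ℝ} (hc : 0 ≤ c)
    (hZ : Z.IsSymm) (h1 : (c • S - Z).PosSemidef) (h2 : (c • S + Z).PosSemidef) :
    spNorm Z ≤ c * spNorm S := by
  refine spNorm_le_of_abs_dotProduct_le hZ (mul_nonneg hc (spNorm_nonneg _)) fun v => ?_
  have h3 := h1.quad_nonneg v
  have h4 := h2.quad_nonneg v
  simp only [Matrix.sub_mulVec, Matrix.add_mulVec, Matrix.smul_mulVec, dotProduct_sub,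
    dotProduct_add, dotProduct_smul, smul_eq_mul] at h3 h4
  have h5 := mul_le_mul_of_nonneg_left (abs_le.1 (abs_dotProduct_mulVec_le S v)).2 hc
  rw [abs_le]
  constructor <;> linarith

lemma posSemidef_smul_one_sub {n : ℕ} {V : Matrix (Fin n) (Fin n) ℝ} {c : ℝ} (hV : V.IsSymm)
    (h : spNorm V ≤ c) : (c • (1 : Matrix (Fin n) (Fin n) ℝ) - V).PosSemidef := by
  refine Matrix.IsSymm.posSemidef_of_quad_nonneg ?_ fun v => ?_
  · exact (Matrix.isSymm_one.smul c).sub hV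
  · simp only [Matrix.sub_mulVec, Matrix.smul_mulVec, dotProduct_sub, dotProduct_smul,
      smul_eq_mul, Matrix.one_mulVec]
    have h1 := (abs_le.1 (abs_dotProduct_mulVec_le V v)).2
    have h2 : 0 ≤ v ⬝ᵥ v := by rw [← vecNorm_sq]; positivity
    nlinarith

lemma spNorm_neg {a b : ℕ} (M : Matrix (Fin a) (Fin b) ℝ) : spNorm (-M) = spNorm M := by
  rw [← neg_one_smul ℝ M, spNorm_smul]; simp

/-- The Gramian equation controls `S * aᵀ` without loss. -/
lemma spNorm_mul_transpose_le {n : ℕ} {a S : Matrix (Fin n) (Fin n) ℝ} (hS : S.PosSemidef)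
    (hlyap : S = 1 + a * S * aᵀ) : spNorm (S * aᵀ) ≤ spNorm S := by
  have h1 : spNorm (a * S * aᵀ) ≤ 1 * spNorm S := by
    have hpsd : (a * S * aᵀ).PosSemidef := by simpa using hS.congr_transpose aᵀ
    refine spNorm_le_of_loewner zero_le_one hpsd.isSymm ?_ ?_
    · have : (1 : ℝ) • S - a * S * aᵀ = 1 := by
        rw [one_smul]; nth_rewrite 1 [hlyap]; abel
      rw [this]; exact Matrix.PosSemidef.one
    · rw [one_smul]; exact hS.add hpsd
  obtain ⟨N, hN⟩ := hS.exists_transpose_mul_self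
  have h2 : spNorm (N * aᵀ) ^ 2 ≤ spNorm N ^ 2 := by
    rw [sq, sq, ← spNorm_transpose_mul_self, ← spNorm_transpose_mul_self, ← hN]
    have : (N * aᵀ)ᵀ * (N * aᵀ) = a * S * aᵀ := by
      rw [hN]; simp [Matrix.transpose_mul, Matrix.mul_assoc]
    rw [this]; linarith
  have h3 := (pow_le_pow_iff_left₀ (spNorm_nonneg _) (spNorm_nonneg _) two_ne_zero).1 h2
  calc spNorm (S * aᵀ) = spNorm (Nᵀ * (N * aᵀ)) := by rw [hN, Matrix.mul_assoc]
    _ ≤ spNorm Nᵀ * spNorm (N * aᵀ) := spNorm_mul_le _ _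
    _ ≤ spNorm N * spNorm N := by
        rw [spNorm_transpose]; exact mul_le_mul_of_nonneg_left h3 (spNorm_nonneg _)
    _ = spNorm S := by rw [hN, spNorm_transpose_mul_self]

lemma spNorm_gramian_increment_le {n : ℕ} {a y S : Matrix (Fin n) (Fin n) ℝ} {ξ s : ℝ}
    (hS : S.PosSemidef) (hlyap : S = 1 + a * S * aᵀ) (hs : spNorm S ≤ s) (hξ : spNorm y ≤ ξ) :
    spNorm ((a + y) * S * (a + y)ᵀ - a * S * aᵀ) ≤ 2 * ξ * s + ξ ^ 2 * s := by
  have hy := spNorm_nonneg y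
  have hS0 := spNorm_nonneg S
  have h1 : spNorm (y * (S * aᵀ)) ≤ ξ * s :=
    (spNorm_mul_le _ _).trans (mul_le_mul hξ ((spNorm_mul_transpose_le hS hlyap).trans hs)
      (spNorm_nonneg _) (hy.trans hξ))
  have h2 : spNorm (y * S * yᵀ) ≤ ξ * s * ξ := by
    refine (spNorm_mul_le _ _).trans (mul_le_mul ((spNorm_mul_le _ _).trans
      (mul_le_mul hξ hs hS0 (hy.trans hξ))) ?_ (spNorm_nonneg _)
      (mul_nonneg (hy.trans hξ) (hS0.trans hs)))
    rwa [spNorm_transpose]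
  have h3 : (a + y) * S * (a + y)ᵀ - a * S * aᵀ =
      y * (S * aᵀ) + (y * (S * aᵀ))ᵀ + y * S * yᵀ := by
    simp only [Matrix.transpose_add, Matrix.transpose_mul, Matrix.transpose_transpose,
      hS.isSymm.eq, Matrix.add_mul, Matrix.mul_add, Matrix.mul_assoc]
    abel
  rw [h3]
  refine (spNorm_add_le _ _).trans ((add_le_add_left (spNorm_add_le _ _) _).trans ?_)
  rw [spNorm_transpose]
  linarith

/-- Perturbation bound for the solution of a discrete Lyapunov equation. -/
lemma spNorm_gramian_sub_le {n : ℕ} {a' S S' V : Matrix (Fin n) (Fin n) ℝ} {δ : ℝ}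
    (ha' : PowDecay a') (hδ : 0 ≤ δ) (hS : S.IsSymm) (hS' : S'.IsSymm) (hV : V.IsSymm)
    (hlyap : S = 1 + a' * S * a'ᵀ - V) (hlyap' : S' = 1 + a' * S' * a'ᵀ) (hVδ : spNorm V ≤ δ) :
    spNorm (S' - S) ≤ δ * spNorm S' := by
  have h : S' - S - a' * (S' - S) * a'ᵀ = V := by
    nth_rewrite 1 [hlyap, hlyap']
    simp only [Matrix.mul_sub, Matrix.sub_mul]
    abel
  refine spNorm_le_of_loewner hδ (hS'.sub hS) (ha'.posSemidef ?_) (ha'.posSemidef ?_)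
  · convert posSemidef_smul_one_sub hV hVδ using 1
    rw [← h]
    nth_rewrite 1 [hlyap']
    simp only [Matrix.mul_sub, Matrix.sub_mul, Matrix.mul_smul, Matrix.smul_mul, smul_add]
    abel
  · convert posSemidef_smul_one_sub hV.neg ((spNorm_neg V).le.trans hVδ) using 1
    rw [← h]
    nth_rewrite 1 [hlyap']
    simp only [Matrix.mul_sub, Matrix.sub_mul, Matrix.mul_smul, Matrix.smul_mul, smul_add,
      Matrix.mul_add, Matrix.add_mul]
    abel

lemma trace_eq_trace_mul_gramian {n : ℕ} {a S : Matrix (Fin n) (Fin n) ℝ}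
    (hlyap : S = 1 + a * S * aᵀ) (P : Matrix (Fin n) (Fin n) ℝ) :
    P.trace = ((P - aᵀ * P * a) * S).trace := by
  have h1 : (aᵀ * P * a * S).trace = (P * (a * S * aᵀ)).trace := by
    rw [Matrix.mul_assoc, Matrix.mul_assoc, Matrix.trace_mul_comm]
    simp only [Matrix.mul_assoc]
  have h2 : a * S * aᵀ = S - 1 := by nth_rewrite 2 [hlyap]; abel
  rw [Matrix.sub_mul, Matrix.trace_sub, h1, h2, Matrix.mul_sub, Matrix.trace_sub, Matrix.mul_one]
  ring

/-- Exact expansion of the cost around a gain, in terms of the perturbed Gramian. -/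
lemma trace_cost_sub {n m : ℕ} {a P P' Q S' : Matrix (Fin n) (Fin n) ℝ}
    {b : Matrix (Fin n) (Fin m) ℝ} {R : Matrix (Fin m) (Fin m) ℝ} {F X : Matrix (Fin m) (Fin n) ℝ}
    (hR : R.IsSymm) (hPs : P.IsSymm) (hS' : S'.IsSymm)
    (hP : P = Q + Fᵀ * R * F + aᵀ * P * a)
    (hP' : P' = Q + (F - X)ᵀ * R * (F - X) + (a + b * X)ᵀ * P' * (a + b * X))
    (hlyap' : S' = 1 + (a + b * X) * S' * (a + b * X)ᵀ) :
    P'.trace - P.trace = -2 * ((R * F - bᵀ * P * a) * S' * Xᵀ).trace +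
      ((R + bᵀ * P * b) * X * S' * Xᵀ).trace := by
  set E := R * F - bᵀ * P * a with hE
  have h1 : P' - (a + b * X)ᵀ * P' * (a + b * X) - (P - (a + b * X)ᵀ * P * (a + b * X)) =
      -(Xᵀ * E) - Eᵀ * X + Xᵀ * ((R + bᵀ * P * b) * X) := by
    have hQ : Q = P - Fᵀ * R * F - aᵀ * P * a := by nth_rewrite 1 [hP]; abel
    nth_rewrite 1 [hP']
    rw [hQ, hE]
    simp only [Matrix.transpose_add, Matrix.transpose_sub, Matrix.transpose_mul, hR.eq, hPs.eq,
      Matrix.transpose_transpose, Matrix.add_mul, Matrix.mul_add, Matrix.sub_mul, Matrix.mul_sub,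
      Matrix.mul_assoc]
    abel
  rw [trace_eq_trace_mul_gramian hlyap' P', trace_eq_trace_mul_gramian hlyap' P,
    ← Matrix.trace_sub, ← Matrix.sub_mul, h1]
  have h2 : (Xᵀ * E * S').trace = (E * S' * Xᵀ).trace := by
    rw [Matrix.mul_assoc, Matrix.trace_mul_comm]
  have h3 : (Eᵀ * X * S').trace = (E * S' * Xᵀ).trace := by
    rw [← Matrix.trace_transpose]
    simp only [Matrix.transpose_mul, Matrix.transpose_transpose, hS'.eq]
    rw [← Matrix.mul_assoc, Matrix.trace_mul_comm, ← Matrix.mul_assoc]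
  have h4 : (Xᵀ * ((R + bᵀ * P * b) * X) * S').trace =
      ((R + bᵀ * P * b) * X * S' * Xᵀ).trace := by
    rw [Matrix.mul_assoc, Matrix.trace_mul_comm]
  rw [Matrix.add_mul, Matrix.sub_mul, Matrix.neg_mul, Matrix.trace_add, Matrix.trace_sub,
    Matrix.trace_neg, h2, h3, h4]
  ring

lemma spNorm_le_of_posSemidef {n : ℕ} {S : Matrix (Fin n) (Fin n) ℝ} {c : ℝ} (hc : 0 ≤ c)
    (hS : S.PosSemidef) (h : (c • (1 : Matrix (Fin n) (Fin n) ℝ) - S).PosSemidef) :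
    spNorm S ≤ c := by
  refine spNorm_le_of_abs_dotProduct_le hS.isSymm hc fun v => ?_
  have h1 := h.quad_nonneg v
  rw [abs_of_nonneg (hS.quad_nonneg v)]
  simp only [Matrix.sub_mulVec, Matrix.smul_mulVec, dotProduct_sub, dotProduct_smul, smul_eq_mul,
    Matrix.one_mulVec] at h1
  linarith

lemma posSemidef_of_sub_smul_one {n : ℕ} {S : Matrix (Fin n) (Fin n) ℝ} {c : ℝ} (hc : 0 ≤ c)
    (h : (S - c • (1 : Matrix (Fin n) (Fin n) ℝ)).PosSemidef) : S.PosSemidef := by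
  have := h.add (Matrix.PosSemidef.one.smul hc)
  rwa [sub_add_cancel] at this

section ClosedLoop

variable {n m p : ℕ} {A : Matrix (Fin n) (Fin n) ℝ} {B : Matrix (Fin n) (Fin m) ℝ}
  {C : Matrix (Fin p) (Fin n) ℝ} {Q : Matrix (Fin n) (Fin n) ℝ} {R : Matrix (Fin m) (Fin m) ℝ}
  {γ : ℝ} {K : Matrix (Fin m) (Fin p) ℝ}

lemma stageCost_eq : Q + Cᵀ * Kᵀ * R * K * C = Q + (K * C)ᵀ * R * (K * C) := by
  simp only [Matrix.transpose_mul, Matrix.mul_assoc]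

lemma Pmat_lyapunov (hγ : 0 ≤ γ) (h : PowDecay (√γ • Acl A B C K)) :
    Pmat A B C Q R γ K = Q + (K * C)ᵀ * R * (K * C) +
      (√γ • Acl A B C K)ᵀ * Pmat A B C Q R γ K * (√γ • Acl A B C K) := by
  have h1 := h.transpose.lyapunov_eq (Q + (K * C)ᵀ * R * (K * C))
  have h2 : Pmat A B C Q R γ K = ∑' t : ℕ, (√γ • Acl A B C K)ᵀ ^ t *
      (Q + (K * C)ᵀ * R * (K * C)) * (√γ • Acl A B C K)ᵀᵀ ^ t := by
    refine tsum_congr fun t => ?_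
    rw [stageCost_eq, Matrix.transpose_transpose, Matrix.transpose_smul, smul_pow, smul_pow,
      Matrix.smul_mul, Matrix.smul_mul, Matrix.mul_smul, smul_smul, ← mul_pow,
      Real.mul_self_sqrt hγ]
  rw [← h2, Matrix.transpose_transpose] at h1
  exact h1

lemma Smat_lyapunov (hγ : 0 ≤ γ) (h : PowDecay (√γ • Acl A B C K)) :
    Smat A B C γ K = 1 + (√γ • Acl A B C K) * Smat A B C γ K * (√γ • Acl A B C K)ᵀ := by
  have h1 := h.lyapunov_eq 1
  have h2 : Smat A B C γ K = ∑' t : ℕ, (√γ • Acl A B C K) ^ t * 1 * (√γ • Acl A B C K)ᵀ ^ t := by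
    refine tsum_congr fun t => ?_
    rw [Matrix.mul_one, Matrix.transpose_smul, smul_pow, smul_pow, Matrix.smul_mul,
      Matrix.mul_smul, smul_smul, ← mul_pow, Real.mul_self_sqrt hγ]
  rwa [← h2] at h1

lemma Egrad_eq (hγ : 0 ≤ γ) :
    Egrad A B C Q R γ K = R * (K * C) -
      (√γ • B)ᵀ * Pmat A B C Q R γ K * (√γ • Acl A B C K) := by
  rw [Egrad, Acl, Matrix.transpose_smul, Matrix.smul_mul, Matrix.smul_mul, Matrix.mul_smul,
    smul_smul, Real.mul_self_sqrt hγ]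
  simp only [Matrix.add_mul, Matrix.mul_sub, Matrix.smul_mul, Matrix.mul_assoc, smul_sub]
  abel

end ClosedLoop

lemma posSemidef_gramian {n : ℕ} {a S : Matrix (Fin n) (Fin n) ℝ} (ha : PowDecay a)
    (hlyap : S = 1 + a * S * aᵀ) : S.PosSemidef := by
  refine ha.posSemidef ?_
  have : S - a * S * aᵀ = 1 := by nth_rewrite 1 [hlyap]; abel
  rw [this]
  exact Matrix.PosSemidef.one

lemma posSemidef_costMatrix {n : ℕ} {a P N : Matrix (Fin n) (Fin n) ℝ} (ha : PowDecay a)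
    (hlyap : P = N + aᵀ * P * a) (hN : N.PosSemidef) : P.PosSemidef := by
  refine ha.transpose.posSemidef ?_
  have : P - aᵀ * P * aᵀᵀ = N := by
    rw [Matrix.transpose_transpose]; nth_rewrite 1 [hlyap]; abel
  rwa [this]

/-- Bounds on the Gramian, the closed loop and the feedback term implied by a cost bound. -/
lemma bounds_of_cost_le {n m : ℕ} (hn : 1 ≤ n) {a P Q S : Matrix (Fin n) (Fin n) ℝ}
    {R : Matrix (Fin m) (Fin m) ℝ} {F : Matrix (Fin m) (Fin n) ℝ} {ℓ ν : ℝ} (hℓ : 0 < ℓ)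
    (ha : PowDecay a)
    (hQ : (Q - ℓ • (1 : Matrix (Fin n) (Fin n) ℝ)).PosSemidef)
    (hR : (R - ℓ • (1 : Matrix (Fin m) (Fin m) ℝ)).PosSemidef)
    (hP : P = Q + Fᵀ * R * F + aᵀ * P * a) (hS : S = 1 + a * S * aᵀ) (hν : P.trace ≤ ν) :
    S.trace ≤ ν / ℓ ∧ 1 ≤ ν / ℓ ∧ frobNorm a ^ 2 ≤ ν / ℓ - 1 ∧ frobNorm F ^ 2 ≤ ν / ℓ - 1 := by
  have hQ0 := posSemidef_of_sub_smul_one hℓ.le hQ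
  have hR0 := posSemidef_of_sub_smul_one hℓ.le hR
  have hFRF := hR0.congr_transpose F
  have hSpsd := posSemidef_gramian ha hS
  have hPpsd := posSemidef_costMatrix ha hP (hQ0.add hFRF)
  have hn' : (1 : ℝ) ≤ n := by exact_mod_cast hn
  have htr : S.trace ≤ ν / ℓ := by
    rw [le_div_iff₀ hℓ]
    have h1 := trace_eq_trace_mul_gramian hS P
    have h2 : P - aᵀ * P * a =
        (Q - ℓ • (1 : Matrix (Fin n) (Fin n) ℝ)) + Fᵀ * R * F + ℓ • 1 := by
      nth_rewrite 1 [hP]; abel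
    rw [h2, Matrix.add_mul, Matrix.trace_add, Matrix.smul_mul, Matrix.one_mul,
      Matrix.trace_smul, smul_eq_mul] at h1
    have h3 := trace_mul_nonneg_of_posSemidef (hQ.add hFRF) hSpsd
    linarith
  have haf : (n : ℝ) + frobNorm a ^ 2 ≤ S.trace := by
    have h1 : S = 1 + a * aᵀ + a * (a * S * aᵀ) * aᵀ := by
      nth_rewrite 1 [hS]
      nth_rewrite 1 [hS]
      simp only [Matrix.mul_add, Matrix.add_mul, Matrix.mul_one]
      abel
    have h2 : (a * (a * S * aᵀ) * aᵀ).PosSemidef := by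
      simpa using ((hSpsd.congr_transpose aᵀ).congr_transpose aᵀ)
    have h3 := h2.trace_nonneg
    have h4 := congrArg Matrix.trace h1
    rw [Matrix.trace_add, Matrix.trace_add, Matrix.trace_one, Fintype.card_fin,
      ← frobNorm_sq_eq_trace] at h4
    linarith
  have hF : ℓ * n + ℓ * frobNorm F ^ 2 ≤ ν := by
    have h1 : P = (Q - ℓ • (1 : Matrix (Fin n) (Fin n) ℝ)) + ℓ • 1 +
        (Fᵀ * (R - ℓ • (1 : Matrix (Fin m) (Fin m) ℝ)) * F + ℓ • (Fᵀ * F)) + aᵀ * P * a := by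
      nth_rewrite 1 [hP]
      simp only [Matrix.mul_sub, Matrix.sub_mul, Matrix.mul_smul, Matrix.smul_mul, Matrix.mul_one]
      abel
    have h2 := (hR.congr_transpose F).trace_nonneg
    have h3 := (hPpsd.congr_transpose a).trace_nonneg
    have h4 := hQ.trace_nonneg
    have h5 := congrArg Matrix.trace h1
    rw [Matrix.trace_add, Matrix.trace_add, Matrix.trace_add, Matrix.trace_add, Matrix.trace_smul,
      Matrix.trace_smul, Matrix.trace_one, Fintype.card_fin, ← frobNorm_sq_eq_trace', smul_eq_mul,
      smul_eq_mul] at h5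
    linarith
  have hF' : (n : ℝ) + frobNorm F ^ 2 ≤ ν / ℓ := by
    rw [le_div_iff₀ hℓ]; linarith
  refine ⟨htr, ?_, ?_, ?_⟩ <;> nlinarith [sq_nonneg (frobNorm F)]

lemma frobNorm_gradientFactor_le {n m : ℕ} {a P : Matrix (Fin n) (Fin n) ℝ}
    {b : Matrix (Fin n) (Fin m) ℝ} {R : Matrix (Fin m) (Fin m) ℝ} {F : Matrix (Fin m) (Fin n) ℝ}
    {ℓ ψ ν t : ℝ} (hR : spNorm R ≤ ℓ) (hb : spNorm b ≤ ψ) (hP : spNorm P ≤ ν)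
    (ha : frobNorm a ≤ t) (hF : frobNorm F ≤ t) :
    frobNorm (R * F - bᵀ * P * a) ≤ (ℓ + ψ * ν) * t := by
  have h1 : frobNorm (R * F) ≤ ℓ * t :=
    (frobNorm_mul_le_spNorm_mul _ _).trans
      (mul_le_mul hR hF (frobNorm_nonneg _) ((spNorm_nonneg _).trans hR))
  have h2 : spNorm (bᵀ * P) ≤ ψ * ν := by
    refine (spNorm_mul_le _ _).trans (mul_le_mul ?_ hP (spNorm_nonneg _)
      ((spNorm_nonneg _).trans hb))
    rwa [spNorm_transpose]
  have h3 : frobNorm (bᵀ * P * a) ≤ ψ * ν * t :=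
    (frobNorm_mul_le_spNorm_mul _ _).trans
      (mul_le_mul h2 ha (frobNorm_nonneg _) ((spNorm_nonneg _).trans h2))
  refine (frobNorm_sub_le _ _).trans ?_
  linarith

lemma remainder_scalar_bound {u t ℓ ψ ν x δ σ : ℝ} (hu : 1 ≤ u) (ht : 0 ≤ t) (htu : t ^ 2 = u - 1)
    (hℓ : 0 ≤ ℓ) (hψ : 1 ≤ ψ) (hν : 0 ≤ ν) (hx : 0 ≤ x)
    (hδ : δ ≤ 17 / 8 * (ψ * x * u)) (hσ0 : 0 ≤ σ) (hσ : σ ≤ 64 / 47 * u) :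
    2 * ((ℓ + ψ * ν) * t * (δ * σ) * x) + (ℓ + ψ ^ 2 * ν) * (x ^ 2 * σ) ≤
      4 * u ^ 3 * (ψ * (ℓ + ψ * ν)) * x ^ 2 := by
  have hL : 0 ≤ ℓ + ψ * ν := by positivity
  have hψ0 : 0 ≤ ψ := by linarith
  have h1 : δ * σ ≤ 17 / 8 * (ψ * x * u) * (64 / 47 * u) :=
    mul_le_mul hδ hσ hσ0 (by positivity)
  have h2 : 2 * ((ℓ + ψ * ν) * t * (δ * σ) * x) ≤
      2 * ((ℓ + ψ * ν) * t * (17 / 8 * (ψ * x * u) * (64 / 47 * u)) * x) := by gcongr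
  have h3 : ℓ + ψ ^ 2 * ν ≤ ψ * (ℓ + ψ * ν) := by nlinarith
  have h4 : (ℓ + ψ ^ 2 * ν) * (x ^ 2 * σ) ≤ ψ * (ℓ + ψ * ν) * (x ^ 2 * (64 / 47 * u)) := by
    gcongr
  have h5 : t ≤ 5 / 8 * u - 9 / 40 := by nlinarith [sq_nonneg (t - 4 / 5)]
  have h6 : 272 / 47 * (t * u ^ 2) + 64 / 47 * u ≤ 4 * u ^ 3 := by
    have h7 : t * u ^ 2 ≤ (5 / 8 * u - 9 / 40) * u ^ 2 := by gcongr
    nlinarith [mul_nonneg (mul_nonneg (sub_nonneg.2 hu) (sub_nonneg.2 hu)) (sub_nonneg.2 hu),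
      mul_nonneg (sub_nonneg.2 hu) (sub_nonneg.2 hu)]
  have h8 := mul_le_mul_of_nonneg_right h6 (show 0 ≤ ψ * (ℓ + ψ * ν) * x ^ 2 by positivity)
  linarith

/-- The scalar consequences of the step-size restriction. -/
lemma step_scalar_bound {u ξ δ : ℝ} (hu : 1 ≤ u) (hξ0 : 0 ≤ ξ) (hξ : ξ * √u ^ 3 ≤ 1 / 8)
    (hδ : δ = 2 * ξ * u + ξ ^ 2 * u) : δ ≤ 17 / 8 * (ξ * u) ∧ δ ≤ 17 / 64 := by
  have hk : 1 ≤ √u := Real.one_le_sqrt.2 hu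
  have hk2 : √u ^ 2 = u := Real.sq_sqrt (by linarith)
  have h1 : u ≤ √u ^ 3 := by nlinarith
  have h2 : ξ * u ≤ 1 / 8 := (mul_le_mul_of_nonneg_left h1 hξ0).trans hξ
  have h3 : ξ ≤ 1 / 8 := by nlinarith
  constructor <;> nlinarith [mul_nonneg hξ0 (by linarith : (0 : ℝ) ≤ u)]

/-- An inexact gradient `ghat` of `g` is a direction of ascent along `g`. -/
lemma trace_mul_transpose_inexact_ge {a b : ℕ} {g ghat : Matrix (Fin a) (Fin b) ℝ} {ε : ℝ}
    (hghat : frobNorm (ghat - g) ≤ ε / 3) :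
    3 / 4 * frobNorm ghat ^ 2 - ε ^ 2 / 9 ≤ (g * ghatᵀ).trace := by
  have hsymm : (ghat * gᵀ).trace = (g * ghatᵀ).trace := by
    rw [← Matrix.trace_transpose, Matrix.transpose_mul, Matrix.transpose_transpose]
  have he : frobNorm (ghat - g) ^ 2 =
      frobNorm ghat ^ 2 - 2 * (g * ghatᵀ).trace + frobNorm g ^ 2 := by
    rw [frobNorm_sq_eq_trace, frobNorm_sq_eq_trace, frobNorm_sq_eq_trace, Matrix.transpose_sub,
      Matrix.sub_mul, Matrix.mul_sub, Matrix.mul_sub, Matrix.trace_sub, Matrix.trace_sub,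
      Matrix.trace_sub, hsymm]
    ring
  have hesq : frobNorm (ghat - g) ^ 2 ≤ ε ^ 2 / 9 := by
    have := pow_le_pow_left₀ (frobNorm_nonneg _) hghat 2
    linarith
  have hpar : frobNorm ghat ^ 2 ≤ 2 * frobNorm g ^ 2 + 2 * frobNorm (ghat - g) ^ 2 := by
    have h1 := frobNorm_add_le (ghat - g) g
    rw [sub_add_cancel] at h1
    have h2 := pow_le_pow_left₀ (frobNorm_nonneg _) h1 2
    linarith [sq_nonneg (frobNorm (ghat - g) - frobNorm g)]
  linarith

/-- The quadratic remainder of a step of size `η` is at most a quarter of the decrease. -/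
lemma quadratic_remainder_le {κ G ψ φ c η ε x : ℝ} (hκ : 1 ≤ κ) (hψ : 1 ≤ ψ) (hφ : 1 ≤ φ)
    (hη : 0 < η) (hε : 0 < ε) (hG : G = 2 * κ ^ 3 * φ * c)
    (hηG : η * (G + ε) ≤ 1 / (8 * κ ^ 3 * ψ * φ)) :
    4 * (κ ^ 2) ^ 3 * (ψ * c) * φ ^ 2 * (η * x) ^ 2 ≤ η / 4 * x ^ 2 := by
  have h1 : η * G * (8 * κ ^ 3 * ψ * φ) ≤ 1 := by
    rw [← le_div_iff₀ (by positivity)]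
    exact (mul_le_mul_of_nonneg_left (by linarith) hη.le).trans hηG
  have h2 := mul_le_mul_of_nonneg_right h1 (show 0 ≤ η / 4 * x ^ 2 by positivity)
  calc _ = η * G * (8 * κ ^ 3 * ψ * φ) * (η / 4 * x ^ 2) := by rw [hG]; ring
    _ ≤ _ := by linarith

section Descent

variable {n m p : ℕ} {A : Matrix (Fin n) (Fin n) ℝ} {B : Matrix (Fin n) (Fin m) ℝ}
  {C : Matrix (Fin p) (Fin n) ℝ} {Q : Matrix (Fin n) (Fin n) ℝ} {R : Matrix (Fin m) (Fin m) ℝ}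
  {γ ℓ₀ ℓ₁ ψ φ ν : ℝ} {K : Matrix (Fin m) (Fin p) ℝ}

lemma smul_Acl_sub (Δ : Matrix (Fin m) (Fin p) ℝ) :
    √γ • Acl A B C (K - Δ) = √γ • Acl A B C K + (√γ • B) * (Δ * C) := by
  simp only [Acl, Matrix.mul_sub, Matrix.sub_mul, Matrix.smul_mul, Matrix.mul_assoc, smul_sub]
  abel

lemma spNorm_sqrt_smul_le {a b : ℕ} {M : Matrix (Fin a) (Fin b) ℝ} (hγ : γ ∈ Set.Ioc (0 : ℝ) 1)
    (hM : spNorm M ≤ ψ) : spNorm (√γ • M) ≤ ψ := by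
  rw [spNorm_smul, abs_of_nonneg (Real.sqrt_nonneg _)]
  have h1 : √γ ≤ 1 := Real.sqrt_le_one.2 hγ.2
  nlinarith [spNorm_nonneg M]

/-- Spectral and Frobenius bounds at a stabilizing gain whose cost is at most `ν`. -/
lemma bounds_at_gain (hn : 1 ≤ n) (hℓ₀ : 0 < ℓ₀) (hℓ₀₁ : ℓ₀ ≤ ℓ₁)
    (hQlb : (Q - ℓ₀ • (1 : Matrix (Fin n) (Fin n) ℝ)).PosSemidef)
    (hRlb : (R - ℓ₀ • (1 : Matrix (Fin m) (Fin m) ℝ)).PosSemidef)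
    (hRub : (ℓ₁ • (1 : Matrix (Fin m) (Fin m) ℝ) - R).PosSemidef)
    (hB : spNorm B ≤ ψ) (hγ : γ ∈ Set.Ioc (0 : ℝ) 1)
    (hK : inS A B C γ K) (hKν : Jcost A B C Q R γ K ≤ ν) :
    (Pmat A B C Q R γ K).PosSemidef ∧ spNorm (Pmat A B C Q R γ K) ≤ ν ∧ spNorm R ≤ ℓ₁ ∧
      (Smat A B C γ K).PosSemidef ∧ spNorm (Smat A B C γ K) ≤ ν / ℓ₀ ∧ 1 ≤ ν / ℓ₀ ∧
      frobNorm (Egrad A B C Q R γ K) ≤ (ℓ₁ + ψ * ν) * √(ν / ℓ₀ - 1) := by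
  have hpow := powDecay_of_inS hn hγ.1 hK
  have hP := Pmat_lyapunov (Q := Q) (R := R) hγ.1.le hpow
  have hS := Smat_lyapunov hγ.1.le hpow
  have hR0 := posSemidef_of_sub_smul_one hℓ₀.le hRlb
  have hPpsd := posSemidef_costMatrix hpow hP
    ((posSemidef_of_sub_smul_one hℓ₀.le hQlb).add (hR0.congr_transpose _))
  have hSpsd := posSemidef_gramian hpow hS
  have hPν : spNorm (Pmat A B C Q R γ K) ≤ ν := (spNorm_le_trace hPpsd).trans hKν
  have hRs := spNorm_le_of_posSemidef (hℓ₀.le.trans hℓ₀₁) hR0 hRub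
  obtain ⟨h1, h2, h3, h4⟩ := bounds_of_cost_le hn hℓ₀ hpow hQlb hRlb hP hS hKν
  refine ⟨hPpsd, hPν, hRs, hSpsd, (spNorm_le_trace hSpsd).trans h1, h2, ?_⟩
  rw [Egrad_eq hγ.1.le]
  exact frobNorm_gradientFactor_le hRs (spNorm_sqrt_smul_le hγ hB) hPν
    (Real.le_sqrt_of_sq_le h3) (Real.le_sqrt_of_sq_le h4)

/-- A small step from a stabilizing gain is stabilizing, with a quadratic upper bound on the
cost. -/
lemma descent_of_small_step (hn : 1 ≤ n) (hRsymm : R.IsSymm) (hℓ₀ : 0 < ℓ₀) (hℓ₀₁ : ℓ₀ ≤ ℓ₁)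
    (hψ : 1 ≤ ψ) (hφ : 1 ≤ φ)
    (hQlb : (Q - ℓ₀ • (1 : Matrix (Fin n) (Fin n) ℝ)).PosSemidef)
    (hRlb : (R - ℓ₀ • (1 : Matrix (Fin m) (Fin m) ℝ)).PosSemidef)
    (hRub : (ℓ₁ • (1 : Matrix (Fin m) (Fin m) ℝ) - R).PosSemidef)
    (hB : spNorm B ≤ ψ) (hC : spNorm C ≤ φ) (hγ : γ ∈ Set.Ioc (0 : ℝ) 1) (hν : 0 < ν)
    (hK : inS A B C γ K) (hKν : Jcost A B C Q R γ K ≤ ν) (Δ : Matrix (Fin m) (Fin p) ℝ)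
    (hΔ : frobNorm Δ ≤ 1 / (8 * √(ν / ℓ₀) ^ 3 * ψ * φ)) :
    inS A B C γ (K - Δ) ∧ Jcost A B C Q R γ (K - Δ) ≤
      Jcost A B C Q R γ K - (gradJ A B C Q R γ K * Δᵀ).trace +
        4 * (ν / ℓ₀) ^ 3 * (ψ * (ℓ₁ + ψ * ν)) * φ ^ 2 * frobNorm Δ ^ 2 := by
  obtain ⟨hPpsd, hPν, hRs, hSpsd, hSu, hu, hE⟩ :=
    bounds_at_gain hn hℓ₀ hℓ₀₁ hQlb hRlb hRub hB hγ hK hKν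
  have hpow := powDecay_of_inS hn hγ.1 hK
  have hP := Pmat_lyapunov (Q := Q) (R := R) hγ.1.le hpow
  have hS := Smat_lyapunov hγ.1.le hpow
  have hψ0 : 0 < ψ := by linarith
  have hφ0 : 0 < φ := by linarith
  have hbψ := spNorm_sqrt_smul_le hγ hB
  have hEeq := Egrad_eq (A := A) (B := B) (C := C) (Q := Q) (R := R) (K := K) hγ.1.le
  set u := ν / ℓ₀ with hu_def
  set a := √γ • Acl A B C K with ha_def
  set b := √γ • B with hb_def
  set P := Pmat A B C Q R γ K with hP_def
  set S := Smat A B C γ K with hS_def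
  set E := Egrad A B C Q R γ K with hE_def
  set X := Δ * C with hX_def
  set x := frobNorm X with hx_def
  have hx0 : 0 ≤ x := frobNorm_nonneg X
  have hxΔ : x ≤ frobNorm Δ * φ :=
    (frobNorm_mul_le_mul_spNorm _ _).trans (mul_le_mul_of_nonneg_left hC (frobNorm_nonneg _))
  have hk : 1 ≤ √u := Real.one_le_sqrt.2 hu
  have hξ : ψ * x * √u ^ 3 ≤ 1 / 8 := by
    rw [le_div_iff₀ (by positivity)] at hΔ
    have : ψ * x * √u ^ 3 ≤ ψ * (frobNorm Δ * φ) * √u ^ 3 := by gcongr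
    linarith
  have hy : spNorm (b * X) ≤ ψ * x :=
    (spNorm_mul_le _ _).trans (mul_le_mul hbψ (spNorm_le_frobNorm X) (spNorm_nonneg _) hψ0.le)
  set δ := 2 * (ψ * x) * u + (ψ * x) ^ 2 * u with hδ_def
  have hδ0 : 0 ≤ δ := by positivity
  obtain ⟨hδ1, hδ2⟩ := step_scalar_bound hu (by positivity) hξ hδ_def
  have hW := spNorm_gramian_increment_le hSpsd hS hSu hy
  rw [← hδ_def] at hW
  have ha' : √γ • Acl A B C (K - Δ) = a + b * X := smul_Acl_sub Δ
  set W := (a + b * X) * S * (a + b * X)ᵀ - a * S * aᵀ with hW_def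
  have hWsymm : W.IsSymm := by
    simp only [Matrix.IsSymm, hW_def, Matrix.transpose_sub, Matrix.transpose_mul,
      Matrix.transpose_transpose, hSpsd.isSymm.eq, Matrix.mul_assoc]
  have hSW : S = 1 + (a + b * X) * S * (a + b * X)ᵀ - W := by
    nth_rewrite 1 [hS]; rw [hW_def]; abel
  have hstab : inS A B C γ (K - Δ) := by
    refine inS_of_certificate hγ.1 (b := u) (c := 1 - δ) (by linarith) (by linarith) hSpsd
      (fun v => ?_) fun v => ?_
    · have h1 := (abs_le.1 (abs_dotProduct_mulVec_le S v)).2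
      have h2 : 0 ≤ v ⬝ᵥ v := by rw [← vecNorm_sq]; positivity
      nlinarith
    · have h1 : γ * (((Acl A B C (K - Δ))ᵀ *ᵥ v) ⬝ᵥ (S *ᵥ ((Acl A B C (K - Δ))ᵀ *ᵥ v))) =
          v ⬝ᵥ (((a + b * X) * S * (a + b * X)ᵀ) *ᵥ v) := by
        rw [← ha', Matrix.transpose_smul, Matrix.smul_mul, Matrix.smul_mul, Matrix.mul_smul,
          smul_smul, Real.mul_self_sqrt hγ.1.le, Matrix.smul_mulVec, dotProduct_smul, smul_eq_mul,
          ← Matrix.mulVec_mulVec, ← Matrix.mulVec_mulVec, Matrix.dotProduct_mulVec v,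
          ← Matrix.mulVec_transpose]
      have h2 : (a + b * X) * S * (a + b * X)ᵀ = S - 1 + W := by
        nth_rewrite 2 [hSW]; abel
      have h3 := (abs_le.1 (abs_dotProduct_mulVec_le W v)).2
      have h4 : 0 ≤ v ⬝ᵥ v := by rw [← vecNorm_sq]; positivity
      rw [h1, h2, Matrix.add_mulVec, Matrix.sub_mulVec, dotProduct_add, dotProduct_sub,
        Matrix.one_mulVec]
      nlinarith
  refine ⟨hstab, ?_⟩
  have hpow' := powDecay_of_inS hn hγ.1 hstab
  have hP' := Pmat_lyapunov (Q := Q) (R := R) hγ.1.le hpow'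
  have hS' := Smat_lyapunov hγ.1.le hpow'
  rw [ha', Matrix.sub_mul] at hP'
  rw [ha'] at hS' hpow'
  set P' := Pmat A B C Q R γ (K - Δ) with hP'_def
  set S' := Smat A B C γ (K - Δ) with hS'_def
  have hS'psd := posSemidef_gramian hpow' hS'
  have hdiff := spNorm_gramian_sub_le hpow' hδ0 hSpsd.isSymm hS'psd.isSymm hWsymm hSW hS' hW
  set σ := spNorm S' with hσ_def
  have hσ0 : 0 ≤ σ := spNorm_nonneg S'
  have hσ : σ ≤ 64 / 47 * u := by
    have h1 : σ ≤ spNorm S + spNorm (S' - S) := by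
      have := spNorm_add_le S (S' - S)
      rwa [add_sub_cancel] at this
    nlinarith
  have hcost := trace_cost_sub hRsymm hPpsd.isSymm hS'psd.isSymm hP hP' hS'
  rw [← hEeq] at hcost
  have hgrad : (gradJ A B C Q R γ K * Δᵀ).trace = 2 * (E * S * Xᵀ).trace := by
    rw [gradJ, Matrix.smul_mul, Matrix.trace_smul, smul_eq_mul, hX_def, Matrix.transpose_mul,
      Matrix.mul_assoc _ Cᵀ Δᵀ]
  have h1 : |(E * (S' - S) * Xᵀ).trace| ≤ (ℓ₁ + ψ * ν) * √(u - 1) * (δ * σ) * x := by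
    refine (trace_mul_transpose_le _ _).trans (mul_le_mul_of_nonneg_right ?_ hx0)
    exact (frobNorm_mul_le_mul_spNorm _ _).trans
      (mul_le_mul hE hdiff (spNorm_nonneg _) ((frobNorm_nonneg _).trans hE))
  have h2 : |((R + bᵀ * P * b) * X * S' * Xᵀ).trace| ≤ (ℓ₁ + ψ ^ 2 * ν) * (x ^ 2 * σ) := by
    have h3 : spNorm (R + bᵀ * P * b) ≤ ℓ₁ + ψ ^ 2 * ν := by
      have h4 : spNorm (bᵀ * P) ≤ ψ * ν := by
        refine (spNorm_mul_le _ _).trans (mul_le_mul ?_ hPν (spNorm_nonneg _) hψ0.le)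
        rwa [spNorm_transpose]
      have h5 : spNorm (bᵀ * P * b) ≤ ψ * ν * ψ :=
        (spNorm_mul_le _ _).trans (mul_le_mul h4 hbψ (spNorm_nonneg _) (by positivity))
      have := spNorm_add_le R (bᵀ * P * b)
      linarith
    calc |((R + bᵀ * P * b) * X * S' * Xᵀ).trace|
        ≤ frobNorm ((R + bᵀ * P * b) * X * S') * x := trace_mul_transpose_le _ _
      _ ≤ (spNorm (R + bᵀ * P * b) * x * σ) * x := by
          refine mul_le_mul_of_nonneg_right ?_ hx0
          exact (frobNorm_mul_le_mul_spNorm _ _).trans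
            (mul_le_mul_of_nonneg_right (frobNorm_mul_le_spNorm_mul _ _) hσ0)
      _ ≤ ((ℓ₁ + ψ ^ 2 * ν) * x * σ) * x := by gcongr
      _ = (ℓ₁ + ψ ^ 2 * ν) * (x ^ 2 * σ) := by ring
  have h3 := remainder_scalar_bound hu (Real.sqrt_nonneg (u - 1))
    (Real.sq_sqrt (by linarith : 0 ≤ u - 1)) (hℓ₀.le.trans hℓ₀₁) hψ hν.le hx0 hδ1 hσ0 hσ
  have h4 : 4 * u ^ 3 * (ψ * (ℓ₁ + ψ * ν)) * x ^ 2 ≤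
      4 * u ^ 3 * (ψ * (ℓ₁ + ψ * ν)) * φ ^ 2 * frobNorm Δ ^ 2 := by
    have hℓ₁ : 0 < ℓ₁ := by linarith
    calc 4 * u ^ 3 * (ψ * (ℓ₁ + ψ * ν)) * x ^ 2
        ≤ 4 * u ^ 3 * (ψ * (ℓ₁ + ψ * ν)) * (frobNorm Δ * φ) ^ 2 := by gcongr
      _ = _ := by ring
  rw [hgrad]
  have h5 : (E * (S' - S) * Xᵀ).trace = (E * S' * Xᵀ).trace - (E * S * Xᵀ).trace := by
    rw [Matrix.mul_sub, Matrix.sub_mul, Matrix.trace_sub]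
  have h6 := (abs_le.1 h1).1
  have h7 := (abs_le.1 h2).2
  rw [h5] at h6
  change P'.trace ≤ P.trace - _ + _
  linarith

lemma frobNorm_gradJ_le (hn : 1 ≤ n) (hℓ₀ : 0 < ℓ₀) (hℓ₀₁ : ℓ₀ ≤ ℓ₁) (hψ : 1 ≤ ψ)
    (hQlb : (Q - ℓ₀ • (1 : Matrix (Fin n) (Fin n) ℝ)).PosSemidef)
    (hRlb : (R - ℓ₀ • (1 : Matrix (Fin m) (Fin m) ℝ)).PosSemidef)
    (hRub : (ℓ₁ • (1 : Matrix (Fin m) (Fin m) ℝ) - R).PosSemidef)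
    (hB : spNorm B ≤ ψ) (hC : spNorm C ≤ φ) (hγ : γ ∈ Set.Ioc (0 : ℝ) 1) (hν : 0 < ν)
    (hK : inS A B C γ K) (hKν : Jcost A B C Q R γ K ≤ ν) :
    frobNorm (gradJ A B C Q R γ K) ≤ 2 * √(ν / ℓ₀) ^ 3 * φ * (ℓ₁ + ψ * ν) := by
  obtain ⟨-, -, -, -, hSu, hu, hE⟩ :=
    bounds_at_gain hn hℓ₀ hℓ₀₁ hQlb hRlb hRub hB hγ hK hKν
  have hℓ₁ : 0 < ℓ₁ := by linarith
  have hφ0 : 0 ≤ φ := (spNorm_nonneg C).trans hC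
  have hE' : frobNorm (Egrad A B C Q R γ K) ≤ (ℓ₁ + ψ * ν) * √(ν / ℓ₀) :=
    hE.trans (mul_le_mul_of_nonneg_left (Real.sqrt_le_sqrt (by linarith)) (by positivity))
  rw [gradJ, frobNorm_smul, abs_two]
  have h1 : frobNorm (Egrad A B C Q R γ K * Smat A B C γ K * Cᵀ) ≤
      (ℓ₁ + ψ * ν) * √(ν / ℓ₀) * (ν / ℓ₀) * φ := by
    refine (frobNorm_mul_le_mul_spNorm _ _).trans
      (mul_le_mul ((frobNorm_mul_le_mul_spNorm _ _).trans ?_) ?_ (spNorm_nonneg _) (by positivity))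
    · exact mul_le_mul hE' hSu (spNorm_nonneg _) (by positivity)
    · rwa [spNorm_transpose]
  have h2 : √(ν / ℓ₀) ^ 3 = √(ν / ℓ₀) * (ν / ℓ₀) := by
    rw [pow_succ, Real.sq_sqrt (by positivity), mul_comm]
  rw [h2]
  linarith

end Descent


/-- one inexact policy-gradient step with stepsize
`η ≤ min{D/(G⁰ + ε), 1/(2L)}` stays stabilizing and decreases the cost:
`J_γ(K − ηghat) ≤ J_γ(K) − η((1/2)‖ghat‖²_F − ε²/9)`. -/
theorem stmt19
    {n m p : ℕ} (hn : 1 ≤ n) (hm : 1 ≤ m) (hp : 1 ≤ p)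
    (A : Matrix (Fin n) (Fin n) ℝ) (B : Matrix (Fin n) (Fin m) ℝ) (C : Matrix (Fin p) (Fin n) ℝ)
    (Q : Matrix (Fin n) (Fin n) ℝ) (R : Matrix (Fin m) (Fin m) ℝ)
    (hQsymm : Q.IsSymm) (hRsymm : R.IsSymm)
    (ℓ₀ ℓ₁ ψ φ : ℝ) (hℓ₀ : 0 < ℓ₀) (hℓ₀₁ : ℓ₀ ≤ ℓ₁) (hψ : 1 ≤ ψ) (hφ : 1 ≤ φ)
    (hQlb : (Q - ℓ₀ • (1 : Matrix (Fin n) (Fin n) ℝ)).PosSemidef)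
    (hQub : (ℓ₁ • (1 : Matrix (Fin n) (Fin n) ℝ) - Q).PosSemidef)
    (hRlb : (R - ℓ₀ • (1 : Matrix (Fin m) (Fin m) ℝ)).PosSemidef)
    (hRub : (ℓ₁ • (1 : Matrix (Fin m) (Fin m) ℝ) - R).PosSemidef)
    (hB : spNorm B ≤ ψ) (hC : spNorm C ≤ φ)
    (γ : ℝ) (hγ : γ ∈ Set.Ioc (0 : ℝ) 1) (ν ε : ℝ) (hν : 0 < ν) (hε : 0 < ε)
    (K : Matrix (Fin m) (Fin p) ℝ)
    (hK : inS A B C γ K) (hKν : Jcost A B C Q R γ K ≤ ν)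
    (ghat : Matrix (Fin m) (Fin p) ℝ)
    (hghat : frobNorm (ghat - gradJ A B C Q R γ K) ≤ ε / 3)
    (η : ℝ) (hηpos : 0 < η)
    (hη : η ≤ min
      ((1 / (8 * Real.sqrt (ν / ℓ₀) ^ 3 * ψ * φ)) /
        (2 * Real.sqrt (ν / ℓ₀) ^ 3 * φ * (ℓ₁ + ψ * ν) * Real.sqrt (min m p) + ε))
      (1 / (2 * (104 * Real.sqrt (ν / ℓ₀) ^ 10 * ℓ₁ * ψ ^ 2 * φ * Real.sqrt (min m p))))) :
    inS A B C γ (K - η • ghat) ∧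
      Jcost A B C Q R γ (K - η • ghat) ≤
        Jcost A B C Q R γ K - η * ((1 / 2) * frobNorm ghat ^ 2 - ε ^ 2 / 9) := by
  obtain ⟨hη1, -⟩ := le_min_iff.1 hη
  have hG := frobNorm_gradJ_le hn hℓ₀ hℓ₀₁ hψ hQlb hRlb hRub hB hC hγ hν hK hKν
  obtain ⟨-, -, -, -, -, hu, -⟩ :=
    bounds_at_gain hn hℓ₀ hℓ₀₁ hQlb hRlb hRub hB hγ hK hKν
  have hk2 : √(ν / ℓ₀) ^ 2 = ν / ℓ₀ := Real.sq_sqrt (by linarith)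
  have hk : 1 ≤ √(ν / ℓ₀) := Real.one_le_sqrt.2 hu
  have hℓ₁ : 0 < ℓ₁ := by linarith
  have hmp : (1 : ℝ) ≤ √(min m p) := by
    rw [Real.one_le_sqrt]
    exact_mod_cast le_min hm hp
  obtain ⟨G, hG_def⟩ : ∃ G, G = 2 * √(ν / ℓ₀) ^ 3 * φ * (ℓ₁ + ψ * ν) := ⟨_, rfl⟩
  have hG0 : 0 < G := by rw [hG_def]; positivity
  rw [← hG_def] at hη1 hG
  have hηGε : η * (G + ε) ≤ 1 / (8 * √(ν / ℓ₀) ^ 3 * ψ * φ) := by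
    refine le_trans ?_ ((le_div_iff₀ (by positivity)).1 hη1)
    refine mul_le_mul_of_nonneg_left ?_ hηpos.le
    linarith [le_mul_of_one_le_right hG0.le hmp]
  have hghatG : frobNorm ghat ≤ G + ε := by
    have h1 := frobNorm_add_le (ghat - gradJ A B C Q R γ K) (gradJ A B C Q R γ K)
    rw [sub_add_cancel] at h1
    linarith
  have hΔeq : frobNorm (η • ghat) = η * frobNorm ghat := by
    rw [frobNorm_smul, abs_of_pos hηpos]
  have hΔ : frobNorm (η • ghat) ≤ 1 / (8 * √(ν / ℓ₀) ^ 3 * ψ * φ) := by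
    rw [hΔeq]
    exact (mul_le_mul_of_nonneg_left hghatG hηpos.le).trans hηGε
  obtain ⟨hstab, hdesc⟩ := descent_of_small_step hn hRsymm hℓ₀ hℓ₀₁ hψ hφ hQlb hRlb hRub hB hC hγ
    hν hK hKν (η • ghat) hΔ
  refine ⟨hstab, hdesc.trans ?_⟩
  have hquad := quadratic_remainder_le (x := frobNorm ghat) hk hψ hφ hηpos hε hG_def hηGε
  rw [hk2] at hquad
  have hfin := mul_le_mul_of_nonneg_left (trace_mul_transpose_inexact_ge hghat) hηpos.le
  rw [Matrix.transpose_smul, Matrix.mul_smul, Matrix.trace_smul, smul_eq_mul, hΔeq]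
  linarith
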